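/- For each i ∈ {1,…,n}, the map U_i defined on W = ker V* by U_i η = P_W(V_i η) + Ṽ_i* η is a unitary operator on W: it maps W into W, satisfies ‖U_i η‖ = ‖η‖ for all η ∈ W, and its range is all of W. -/

import Mathlib

open ContinuousLinearMap Filter Finset

/-- Product of the commuting operators `V i` over a finite index set `s`. -/
noncomputable def opProd {H : Type*} [NormedAddCommGroup H] [InnerProductSpace ℂ H]
    {n : ℕ} (V : Fin n → H →L[ℂ] H) (hcomm : ∀ i j, Commute (V i) (V j))
    (s : Finset (Fin n)) : H →L[ℂ] H :=
  s.noncommProd V fun a _ b _ _ => hcomm a b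

/-- The wandering subspace `ker ((∏_{i ∈ s} V i)^*)`. -/
noncomputable def wSub {H : Type*} [NormedAddCommGroup H] [InnerProductSpace ℂ H] [CompleteSpace H]
    {n : ℕ} (V : Fin n → H →L[ℂ] H) (hcomm : ∀ i j, Commute (V i) (V j))
    (s : Finset (Fin n)) : Submodule ℂ H :=
  LinearMap.ker (ContinuousLinearMap.adjoint (opProd V hcomm s)).toLinearMap

/-- The orthogonal projection of `H` onto `wSub V hcomm s`, as an operator on `H`. -/
noncomputable def wProj {H : Type*} [NormedAddCommGroup H] [InnerProductSpace ℂ H] [CompleteSpace H]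
    {n : ℕ} (V : Fin n → H →L[ℂ] H) (hcomm : ∀ i j, Commute (V i) (V j))
    (s : Finset (Fin n)) : H →L[ℂ] H :=
  haveI : CompleteSpace (wSub V hcomm s) :=
    (ContinuousLinearMap.isClosed_ker _).completeSpace_coe
  (wSub V hcomm s).subtypeL ∘L Submodule.orthogonalProjectionOnto (wSub V hcomm s)

/-- The operator `U_i = P_W ∘ V_i + Ṽ_i^*`, which restricts to a unitary on `W`. -/
noncomputable def Uop {H : Type*} [NormedAddCommGroup H] [InnerProductSpace ℂ H] [CompleteSpace H]
    {n : ℕ} (V : Fin n → H →L[ℂ] H) (hcomm : ∀ i j, Commute (V i) (V j))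
    (i : Fin n) : H →L[ℂ] H :=
  (wProj V hcomm Finset.univ) ∘L V i
    + ContinuousLinearMap.adjoint (opProd V hcomm (Finset.univ.erase i))

/-- A product of commuting isometries is an isometry. -/
theorem norm_opProd_apply {H : Type*} [NormedAddCommGroup H] [InnerProductSpace ℂ H]
    {n : ℕ} (V : Fin n → H →L[ℂ] H) (hiso : ∀ i x, ‖V i x‖ = ‖x‖)
    (hcomm : ∀ i j, Commute (V i) (V j)) (s : Finset (Fin n)) (x : H) :
    ‖opProd V hcomm s x‖ = ‖x‖ := by
  suffices h : ∀ x, ‖opProd V hcomm s x‖ = ‖x‖ from h x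
  refine Finset.noncommProd_induction s V _ (fun T : H →L[ℂ] H => ∀ x, ‖T x‖ = ‖x‖)
    (fun S T hS hT x => ?_) (fun x => ?_) (fun i _ x => hiso i x)
  · rw [ContinuousLinearMap.mul_def, comp_apply, hS, hT]
  · rfl

theorem mul_opProd_erase {H : Type*} [NormedAddCommGroup H] [InnerProductSpace ℂ H]
    {n : ℕ} (V : Fin n → H →L[ℂ] H) (hcomm : ∀ i j, Commute (V i) (V j)) (i : Fin n) :
    V i * opProd V hcomm (Finset.univ.erase i) = opProd V hcomm Finset.univ :=
  Finset.mul_noncommProd_erase _ (Finset.mem_univ i) V _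

theorem opProd_erase_mul {H : Type*} [NormedAddCommGroup H] [InnerProductSpace ℂ H]
    {n : ℕ} (V : Fin n → H →L[ℂ] H) (hcomm : ∀ i j, Commute (V i) (V j)) (i : Fin n) :
    opProd V hcomm (Finset.univ.erase i) * V i = opProd V hcomm Finset.univ :=
  Finset.noncommProd_erase_mul _ (Finset.mem_univ i) V _

theorem adjoint_apply_apply_of_norm_map {H : Type*} [NormedAddCommGroup H]
    [InnerProductSpace ℂ H] [CompleteSpace H] {T : H →L[ℂ] H} (hT : ∀ x, ‖T x‖ = ‖x‖) (x : H) :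
    adjoint T (T x) = x :=
  DFunLike.congr_fun (T.norm_map_iff_adjoint_comp_self.1 hT) x

theorem mem_wSub_iff {H : Type*} [NormedAddCommGroup H] [InnerProductSpace ℂ H] [CompleteSpace H]
    {n : ℕ} (V : Fin n → H →L[ℂ] H) (hcomm : ∀ i j, Commute (V i) (V j))
    (s : Finset (Fin n)) (x : H) :
    x ∈ wSub V hcomm s ↔ adjoint (opProd V hcomm s) x = 0 :=
  Iff.rfl

/-- The projection onto `ker T^*`, for `T` a product of commuting isometries, is `1 - T T^*`. -/
theorem wProj_apply {H : Type*} [NormedAddCommGroup H] [InnerProductSpace ℂ H] [CompleteSpace H]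
    {n : ℕ} (V : Fin n → H →L[ℂ] H) (hiso : ∀ i x, ‖V i x‖ = ‖x‖)
    (hcomm : ∀ i j, Commute (V i) (V j)) (s : Finset (Fin n)) (x : H) :
    wProj V hcomm s x = x - opProd V hcomm s (adjoint (opProd V hcomm s) x) := by
  have : CompleteSpace (wSub V hcomm s) :=
    (ContinuousLinearMap.isClosed_ker _).completeSpace_coe
  change (wSub V hcomm s).starProjection x = _
  refine Submodule.eq_starProjection_of_mem_of_inner_eq_zero ?_ fun w hw => ?_
  · rw [mem_wSub_iff, map_sub,
      adjoint_apply_apply_of_norm_map (norm_opProd_apply V hiso hcomm s), sub_self]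
  · rw [sub_sub_cancel, ← adjoint_inner_right, (mem_wSub_iff V hcomm s w).1 hw, inner_zero_right]

/-- For each `i`, the map `U_i η = P_W(V_i η) + Ṽ_i^* η` is a unitary operator on
`W = ker V^*`: it maps `W` into `W`, is isometric on `W`, and maps `W` onto `W`. -/
theorem stmt3 {H : Type*} [NormedAddCommGroup H] [InnerProductSpace ℂ H] [CompleteSpace H]
    {n : ℕ} (hn : 2 ≤ n) (V : Fin n → H →L[ℂ] H)
    (hiso : ∀ i x, ‖V i x‖ = ‖x‖) (hcomm : ∀ i j, Commute (V i) (V j))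
    (hshift : ∀ x : H,
      Tendsto (fun m : ℕ => ((ContinuousLinearMap.adjoint (opProd V hcomm Finset.univ)) ^ m) x)
        atTop (nhds 0))
    (i : Fin n) :
    (∀ η ∈ wSub V hcomm Finset.univ, Uop V hcomm i η ∈ wSub V hcomm Finset.univ) ∧
    (∀ η ∈ wSub V hcomm Finset.univ, ‖Uop V hcomm i η‖ = ‖η‖) ∧
    (∀ ξ ∈ wSub V hcomm Finset.univ,
      ∃ η ∈ wSub V hcomm Finset.univ, Uop V hcomm i η = ξ) := by
  have hT := norm_opProd_apply V hiso hcomm Finset.univ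
  have hB := norm_opProd_apply V hiso hcomm (Finset.univ.erase i)
  have hP := wProj_apply V hiso hcomm Finset.univ
  have hAB := mul_opProd_erase V hcomm i
  have hBA := opProd_erase_mul V hcomm i
  simp only [mem_wSub_iff, Uop, add_apply, comp_apply, hP]
  generalize opProd V hcomm (Finset.univ.erase i) = B at *
  generalize opProd V hcomm Finset.univ = T at *
  have hA := hiso i
  generalize V i = A at *
  have hAA := adjoint_apply_apply_of_norm_map hA
  have hBB := adjoint_apply_apply_of_norm_map hB
  have hTBA (x : H) : adjoint T x = adjoint B (adjoint A x) := by
    rw [← hAB, ContinuousLinearMap.mul_def, adjoint_comp, comp_apply]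
  have hTAB (x : H) : adjoint T x = adjoint A (adjoint B x) := by
    rw [← hBA, ContinuousLinearMap.mul_def, adjoint_comp, comp_apply]
  have hU (x : H) : A x - T (adjoint T (A x)) + adjoint B x
      = A (x - B (adjoint B x)) + adjoint B x := by
    rw [hTBA, hAA, ← hAB, ContinuousLinearMap.mul_def, comp_apply, map_sub]
  simp only [hU]
  refine ⟨fun η hη => ?_, fun η hη => ?_, fun ξ hξ => ?_⟩
  · have hBη : adjoint T (adjoint B η) = 0 := by rw [hTBA, ← hTAB, hη, map_zero]
    rw [map_add, hBη, hTBA, hAA, map_sub, hBB, sub_self, add_zero]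
  · have horth : inner ℂ (A (η - B (adjoint B η))) (adjoint B η) = 0 := by
      rw [← adjoint_inner_right, ← hTAB, hη, inner_zero_right]
    have horth' : inner ℂ (η - B (adjoint B η)) (B (adjoint B η)) = 0 := by
      rw [← adjoint_inner_left, map_sub, hBB, sub_self, inner_zero_left]
    have h := norm_add_sq_eq_norm_sq_add_norm_sq_of_inner_eq_zero _ _ horth
    have h' := norm_add_sq_eq_norm_sq_add_norm_sq_of_inner_eq_zero _ _ horth'
    rw [sub_add_cancel, hB] at h'
    rw [hA, ← h'] at h
    exact (mul_self_inj (norm_nonneg _) (norm_nonneg _)).1 h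
  · have hBη : adjoint B (adjoint A ξ + B (ξ - A (adjoint A ξ))) = ξ - A (adjoint A ξ) := by
      rw [map_add, ← hTBA, hξ, hBB, zero_add]
    refine ⟨adjoint A ξ + B (ξ - A (adjoint A ξ)), ?_, ?_⟩
    · rw [hTAB, hBη, map_sub, hAA, sub_self]
    · rw [hBη, add_sub_cancel_right, add_sub_cancel]
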